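/- Let H_1, H_2 be hyperplanes of T and let u_1, u_2 ∈ V' with r·u_1 ∉ H_1 and r·u_2 ∉ H_2. If the sets C(H_1,u_1) and C(H_2,u_2) have a common element, then C(H_1,u_1) = C(H_2,u_2). -/

import Mathlib

open Matrix

/-- The symplectic form `a M bᵀ` where `M = [[0, Iₑ],[-Iₑ, 0]]`. -/
def sympForm (K : Type) [CommRing K] (e : ℕ) (a b : Fin e ⊕ Fin e → K) : K :=
  a ⬝ᵥ ((Matrix.fromBlocks (0 : Matrix (Fin e) (Fin e) K) 1 (-1) 0) *ᵥ b)

/-- `V'`: the set of 2e-tuples over `K` having at least one unit entry. -/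
def unitTuples (K : Type) [CommRing K] (e : ℕ) : Set (Fin e ⊕ Fin e → K) :=
  {a | ∃ i, IsUnit (a i)}

/-- The equivalence class `[a]` of a tuple under unit scaling. -/
def cls (K : Type) [CommRing K] (e : ℕ) (a : Fin e ⊕ Fin e → K) :
    Set (Fin e ⊕ Fin e → K) :=
  {b | ∃ σ : Kˣ, b = σ • a}

/-- `V`: the set of equivalence classes of elements of `V'` under unit scaling. -/
def classes (K : Type) [CommRing K] (e : ℕ) : Set (Set (Fin e ⊕ Fin e → K)) :=
  {S | ∃ a ∈ unitTuples K e, S = cls K e a}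

/-- Adjacency in the graph `X(2e,K)`: `a M bᵀ ∈ K \ {0}`. -/
def adjX (K : Type) [CommRing K] (e : ℕ) (A B : Set (Fin e ⊕ Fin e → K)) : Prop :=
  ∃ a ∈ A, ∃ b ∈ B, sympForm K e a b ≠ 0

/-- Adjacency in the complement of `X(2e,K)`: distinct classes with `a M bᵀ = 0`. -/
def adjXc (K : Type) [CommRing K] (e : ℕ) (A B : Set (Fin e ⊕ Fin e → K)) : Prop :=
  A ≠ B ∧ ∃ a ∈ A, ∃ b ∈ B, sympForm K e a b = 0

/-- Adjacency in the graph `Y(2e,K)`: `a M bᵀ ∈ J \ {0}`. -/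
def adjY (K : Type) [CommRing K] (J : Ideal K) (e : ℕ)
    (A B : Set (Fin e ⊕ Fin e → K)) : Prop :=
  ∃ a ∈ A, ∃ b ∈ B, sympForm K e a b ∈ J ∧ sympForm K e a b ≠ 0

/-- `T = J × ⋯ × J` (2e factors), as a subset of `K^{2e}`. -/
def Tset (K : Type) [CommRing K] (J : Ideal K) (e : ℕ) : Set (Fin e ⊕ Fin e → K) :=
  {x | ∀ i, x i ∈ J}

/-- A hyperplane of `T`: a `K`-submodule contained in `T` of cardinality `q^(2e-1)`. -/
def IsHyperplane (K : Type) [CommRing K] (J : Ideal K) (e q : ℕ)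
    (H : Submodule K (Fin e ⊕ Fin e → K)) : Prop :=
  (H : Set (Fin e ⊕ Fin e → K)) ⊆ Tset K J e ∧ Nat.card H = q ^ (2 * e - 1)

/-- `C(H,u) = {[u+h] : h ∈ H}`. -/
def classSet (K : Type) [CommRing K] (e : ℕ) (H : Submodule K (Fin e ⊕ Fin e → K))
    (u : Fin e ⊕ Fin e → K) : Set (Set (Fin e ⊕ Fin e → K)) :=
  {S | ∃ h ∈ (H : Set (Fin e ⊕ Fin e → K)), S = cls K e (u + h)}

/-- The set of tuples `{σ • (u+h) : σ ∈ Kˣ, h ∈ H}`. -/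
def orbitSet (K : Type) [CommRing K] (e : ℕ) (H : Submodule K (Fin e ⊕ Fin e → K))
    (u : Fin e ⊕ Fin e → K) : Set (Fin e ⊕ Fin e → K) :=
  {x | ∃ σ : Kˣ, ∃ h ∈ (H : Set (Fin e ⊕ Fin e → K)), x = σ • (u + h)}

/-- The coset `c • u + T` of `T`. -/
def cosetOf (K : Type) [CommRing K] (J : Ideal K) (e : ℕ) (c : K)
    (u : Fin e ⊕ Fin e → K) : Set (Fin e ⊕ Fin e → K) :=
  {x | ∃ t ∈ Tset K J e, x = c • u + t}

section UniqueNontrivialIdeal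

variable {K : Type} [CommRing K] {J : Ideal K} {r : K}

/-- If every ideal is `⊥`, `J` or `⊤`, then the elements outside `J` are units. -/
lemma isUnit_of_notMem (hideals : ∀ I : Ideal K, I = ⊥ ∨ I = J ∨ I = ⊤) {x : K}
    (hx : x ∉ J) : IsUnit x := by
  have hmem : x ∈ Ideal.span {x} := Ideal.mem_span_singleton_self x
  rcases hideals (Ideal.span {x}) with h | h | h
  · rw [h, Ideal.mem_bot] at hmem
    exact absurd (hmem ▸ J.zero_mem) hx
  · exact absurd (h ▸ hmem) hx
  · exact Ideal.span_singleton_eq_top.mp h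

lemma isUnit_one_add_of_mem (hJtop : J ≠ ⊤) (hideals : ∀ I : Ideal K, I = ⊥ ∨ I = J ∨ I = ⊤)
    {x : K} (hx : x ∈ J) : IsUnit (1 + x) :=
  isUnit_of_notMem hideals fun h =>
    hJtop ((Ideal.eq_top_iff_one J).mpr (by simpa using J.sub_mem h hx))

/-- A generator of the unique nontrivial ideal squares to zero. -/
lemma generator_mul_self (hJr : J = Ideal.span {r}) (hJtop : J ≠ ⊤)
    (hideals : ∀ I : Ideal K, I = ⊥ ∨ I = J ∨ I = ⊤) : r * r = 0 := by
  have hr : r ∈ J := hJr ▸ Ideal.mem_span_singleton_self r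
  have hmem : r * r ∈ Ideal.span {r * r} := Ideal.mem_span_singleton_self _
  rcases hideals (Ideal.span {r * r}) with h | h | h
  · rwa [h, Ideal.mem_bot] at hmem
  · obtain ⟨c, hc⟩ := Ideal.mem_span_singleton'.mp (h ▸ hr)
    have hu := isUnit_one_add_of_mem hJtop hideals (J.mul_mem_left (-c) hr)
    have hzero : (1 + -c * r) * r = 0 := by linear_combination -hc
    rw [hu.mul_right_eq_zero.mp hzero, mul_zero]
  · exact absurd (J.eq_top_of_isUnit_mem (J.mul_mem_left r hr)
      (Ideal.span_singleton_eq_top.mp h)) hJtop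

lemma card_le_card_quotient [Finite K] (hJr : J = Ideal.span {r}) (hrr : r * r = 0) :
    Nat.card J ≤ Nat.card (K ⧸ J) := by
  have : Finite (K ⧸ J) := Finite.of_surjective _ Ideal.Quotient.mk_surjective
  refine Nat.card_le_card_of_surjective
    (fun c : K ⧸ J => (⟨c.out * r, J.mul_mem_left _ (hJr ▸ Ideal.mem_span_singleton_self r)⟩ : J))
    ?_
  rintro ⟨x, hx⟩
  obtain ⟨a, rfl⟩ := Ideal.mem_span_singleton'.mp (hJr ▸ hx)
  refine ⟨Ideal.Quotient.mk J a, Subtype.ext ?_⟩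
  have hmem : (Ideal.Quotient.mk J a).out - a ∈ J :=
    Ideal.Quotient.eq.mp (Quotient.out_eq' _)
  have hspan : ∀ y ∈ J, ∃ b, b * r = y := fun y hy =>
    Ideal.mem_span_singleton'.mp (hJr ▸ hy)
  obtain ⟨b, hb⟩ := hspan _ hmem
  change (Ideal.Quotient.mk J a).out * r = a * r
  linear_combination b * hrr - r * hb

lemma card_Tset_le [Finite K] (hJr : J = Ideal.span {r}) (hrr : r * r = 0) (e : ℕ) :
    Nat.card (Tset K J e) ≤ Nat.card (K ⧸ J) ^ (2 * e) := by
  have hcard : Nat.card (Tset K J e) = Nat.card J ^ (2 * e) := by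
    have equiv : Tset K J e ≃ (Fin e ⊕ Fin e → J) := Equiv.subtypePiEquivPi
    rw [Nat.card_congr equiv]
    simp [Nat.card_fun, two_mul]
  rw [hcard]
  exact Nat.pow_le_pow_left (card_le_card_quotient hJr hrr) _

/-- A hyperplane of `T` together with a multiple `r • v` outside it spans `T`. -/
lemma exists_add_of_mem_Tset [Finite K] (hJr : J = Ideal.span {r}) (hrr : r * r = 0)
    (hideals : ∀ I : Ideal K, I = ⊥ ∨ I = J ∨ I = ⊤) {e : ℕ} (he : e ≠ 0)
    {H : Submodule K (Fin e ⊕ Fin e → K)} (hH : IsHyperplane K J e (Nat.card (K ⧸ J)) H)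
    {v : Fin e ⊕ Fin e → K} (hv : r • v ∉ H) {t : Fin e ⊕ Fin e → K} (ht : t ∈ Tset K J e) :
    ∃ c : K, ∃ h ∈ H, t = c • r • v + h := by
  have hr : r ∈ J := hJr ▸ Ideal.mem_span_singleton_self r
  let f : (K ⧸ J) × H → Tset K J e := fun p =>
    ⟨p.1.out • r • v + p.2, fun i =>
      J.add_mem (J.mul_mem_left _ (J.mul_mem_right _ hr)) (hH.1 p.2.2 i)⟩
  have hf : Function.Injective f := by
    rintro ⟨a, h⟩ ⟨b, k⟩ hab
    have heq : a.out • r • v + (h : Fin e ⊕ Fin e → K) = b.out • r • v + k :=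
      congrArg Subtype.val hab
    have hab : a = b := by
      by_contra hne
      have hu : IsUnit (a.out - b.out) := isUnit_of_notMem hideals fun hmem => hne <| by
        rw [← Quotient.out_eq' a, ← Quotient.out_eq' b]
        exact Ideal.Quotient.eq.mpr hmem
      have hdiff : (a.out - b.out) • r • v = k - h := by
        rw [sub_smul, sub_eq_sub_iff_add_eq_add, heq, add_comm]
      exact hv ((H.smul_mem_iff_of_isUnit hu).mp (hdiff ▸ H.sub_mem k.2 h.2))
    subst hab
    exact Prod.ext rfl (Subtype.ext (add_left_cancel heq))
  have hcard : Nat.card (Tset K J e) ≤ Nat.card ((K ⧸ J) × H) := by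
    rw [Nat.card_prod, hH.2, ← pow_succ', Nat.sub_add_cancel (by omega)]
    exact card_Tset_le hJr hrr e
  obtain ⟨⟨c, h⟩, hch⟩ := (hf.bijective_of_nat_card_le hcard).2 ⟨t, ht⟩
  exact ⟨c.out, h, h.2, (congrArg Subtype.val hch).symm⟩

end UniqueNontrivialIdeal

section ClassSet

variable {K : Type} [CommRing K] {e : ℕ} {H : Submodule K (Fin e ⊕ Fin e → K)}

lemma cls_smul (σ : Kˣ) (a : Fin e ⊕ Fin e → K) : cls K e (σ • a) = cls K e a := by
  ext b
  constructor
  · rintro ⟨τ, rfl⟩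
    exact ⟨τ * σ, (mul_smul τ σ a).symm⟩
  · rintro ⟨τ, rfl⟩
    exact ⟨τ * σ⁻¹, by rw [smul_smul, inv_mul_cancel_right]⟩

lemma classSet_add_of_mem {h : Fin e ⊕ Fin e → K} (hh : h ∈ H) (u : Fin e ⊕ Fin e → K) :
    classSet K e H (u + h) = classSet K e H u := by
  ext S
  constructor
  · rintro ⟨k, hk, rfl⟩
    exact ⟨h + k, H.add_mem hh hk, by rw [add_assoc]⟩
  · rintro ⟨k, hk, rfl⟩
    exact ⟨k - h, H.sub_mem hk hh, by rw [add_assoc, add_sub_cancel]⟩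

lemma classSet_smul (σ : Kˣ) (u : Fin e ⊕ Fin e → K) :
    classSet K e H (σ • u) = classSet K e H u := by
  ext S
  constructor
  · rintro ⟨k, hk, rfl⟩
    refine ⟨σ⁻¹ • k, H.smul_mem (σ⁻¹ : Kˣ) hk, ?_⟩
    rw [← cls_smul σ (u + σ⁻¹ • k), smul_add, smul_inv_smul]
  · rintro ⟨k, hk, rfl⟩
    refine ⟨σ • k, H.smul_mem (σ : K) hk, ?_⟩
    rw [← smul_add, cls_smul]

/-- A class `[v + t]` with `t ∈ T` lies in `C(H, v)` whenever `r • v ∉ H`. -/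
lemma cls_add_mem_classSet [Finite K] {J : Ideal K} {r : K} (hJr : J = Ideal.span {r})
    (hJtop : J ≠ ⊤) (hideals : ∀ I : Ideal K, I = ⊥ ∨ I = J ∨ I = ⊤) (he : e ≠ 0)
    (hH : IsHyperplane K J e (Nat.card (K ⧸ J)) H) {v : Fin e ⊕ Fin e → K} (hv : r • v ∉ H)
    {t : Fin e ⊕ Fin e → K} (ht : t ∈ Tset K J e) :
    cls K e (v + t) ∈ classSet K e H v := by
  have hrr := generator_mul_self hJr hJtop hideals
  obtain ⟨c, h, hh, rfl⟩ := exists_add_of_mem_Tset hJr hrr hideals he hH hv ht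
  obtain ⟨σ, hσ⟩ := isUnit_one_add_of_mem hJtop hideals
    (J.mul_mem_left c (hJr ▸ Ideal.mem_span_singleton_self r))
  rw [← classSet_smul σ v]
  refine ⟨h, hh, ?_⟩
  rw [Units.smul_def, hσ, add_smul, one_smul, mul_smul, add_assoc]

lemma smul_add_notMem {r : K} {u h : Fin e ⊕ Fin e → K} (hu : r • u ∉ H) (hh : h ∈ H) :
    r • (u + h) ∉ H := by
  rw [smul_add, H.add_mem_iff_left (H.smul_mem r hh)]
  exact hu

end ClassSet

/-- Proposition: if `C(H₁,u₁)` and `C(H₂,u₂)` share a vertex, they coincide. -/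
theorem classSet_eq_of_inter_nonempty
    (K : Type) [CommRing K] [Fintype K]
    (J : Ideal K) (r : K) (q : ℕ)
    (hJr : J = Ideal.span {r})
    (hJbot : J ≠ ⊥) (hJtop : J ≠ ⊤)
    (hideals : ∀ I : Ideal K, I = ⊥ ∨ I = J ∨ I = ⊤)
    (hq : IsPrimePow q)
    (hqcard : Nat.card (K ⧸ J) = q)
    (e : ℕ) (he : 2 ≤ e)
    (H₁ H₂ : Submodule K (Fin e ⊕ Fin e → K))
    (hH₁ : IsHyperplane K J e q H₁) (hH₂ : IsHyperplane K J e q H₂)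
    (u₁ u₂ : Fin e ⊕ Fin e → K)
    (hu₁ : u₁ ∈ unitTuples K e) (hu₂ : u₂ ∈ unitTuples K e)
    (hru₁ : r • u₁ ∉ H₁) (hru₂ : r • u₂ ∉ H₂)
    (hne : (classSet K e H₁ u₁ ∩ classSet K e H₂ u₂).Nonempty) :
    classSet K e H₁ u₁ = classSet K e H₂ u₂ := by
  subst hqcard
  obtain ⟨S, ⟨h₁, hh₁, rfl⟩, h₂, hh₂, hcls⟩ := hne
  obtain ⟨σ, hσ⟩ : u₂ + h₂ ∈ cls K e (u₁ + h₁) := hcls ▸ ⟨1, (one_smul _ _).symm⟩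
  have hv₁ : r • (u₁ + h₁) ∉ H₁ := smul_add_notMem hru₁ hh₁
  have hv₂ : r • (u₁ + h₁) ∉ H₂ := fun hmem => smul_add_notMem hru₂ hh₂ <| by
    rw [hσ, smul_comm]
    exact H₂.smul_mem (σ : K) hmem
  rw [← classSet_add_of_mem hh₁ u₁, ← classSet_add_of_mem hh₂ u₂, hσ, classSet_smul]
  have he₀ : e ≠ 0 := by omega
  apply Set.Subset.antisymm
  · rintro _ ⟨h, hh, rfl⟩
    exact cls_add_mem_classSet hJr hJtop hideals he₀ hH₂ hv₂ (hH₁.1 hh)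
  · rintro _ ⟨h, hh, rfl⟩
    exact cls_add_mem_classSet hJr hJtop hideals he₀ hH₁ hv₁ (hH₂.1 hh)
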